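/- arXiv:math/0605267 — 4 statements merged into one kernel-verified Lean document; each statement's English description precedes it below -/
import Mathlib

section
/- Let p : ℂ × ℂ → ℂ be the polynomial map p(x,y) = (x² − y³)² + x·y. The set of critical points of p, i.e. the set {(x,y) ∈ ℂ × ℂ : 4x(x² − y³) + y = 0 and −6y²(x² − y³) + x = 0} of common zeros of the two partial derivatives ∂p/∂x and ∂p/∂y, is finite and has exactly 8 elements. -/
/-- A nonzero complex number has exactly `n` distinct `n`-th roots. -/
theorem Complex.ncard_setOf_pow_eq {n : ℕ} (hn : n ≠ 0) {c : ℂ} (hc : c ≠ 0) :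
    {u : ℂ | u ^ n = c}.ncard = n := by
  classical
  have hζ := Complex.isPrimitiveRoot_exp n hn
  have h : {u : ℂ | u ^ n = c} = ((Polynomial.nthRoots n c).toFinset : Set ℂ) := by
    ext u
    simp [Polynomial.mem_nthRoots (Nat.pos_of_ne_zero hn)]
  rw [h, Set.ncard_coe_finset, Multiset.toFinset_card_of_nodup (hζ.nthRoots_nodup hc),
    hζ.card_nthRoots, if_pos (IsAlgClosed.exists_pow_nat_eq c (Nat.pos_of_ne_zero hn))]

/-- The critical points are the origin and the points `(1 / (96 u³), -1 / (24 u²))`, where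
`u = x² - y³` runs over the seventh roots of `5 / 27648`. -/
theorem critical_points_eq_insert_image :
    {z : ℂ × ℂ |
        4 * z.1 * (z.1 ^ 2 - z.2 ^ 3) + z.2 = 0 ∧
        -6 * z.2 ^ 2 * (z.1 ^ 2 - z.2 ^ 3) + z.1 = 0} =
      insert (0, 0) ((fun u : ℂ => (1 / (96 * u ^ 3), -1 / (24 * u ^ 2))) ''
        {u : ℂ | u ^ 7 = 5 / 27648}) := by
  ext ⟨x, y⟩
  simp only [Set.mem_ofPred_eq, Set.mem_insert_iff, Set.mem_image, Prod.mk.injEq]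
  constructor
  · rintro ⟨h1, h2⟩
    by_cases hy : y = 0
    · subst hy
      exact Or.inl ⟨by simpa using h2, rfl⟩
    right
    obtain ⟨u, hu⟩ : ∃ u, u = x ^ 2 - y ^ 3 := ⟨_, rfl⟩
    rw [← hu] at h1 h2
    have hyu : 24 * u ^ 2 * y = -1 :=
      mul_left_cancel₀ hy (by linear_combination h1 - 4 * u * h2)
    have hu0 : u ≠ 0 := by
      rintro rfl
      simp at hyu
    have hy' : y = -1 / (24 * u ^ 2) := by
      field_simp
      linear_combination hyu
    have hx' : x = 1 / (96 * u ^ 3) := by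
      have hx : x = 6 * y ^ 2 * u := by linear_combination h2
      rw [hx, hy']
      field_simp
      norm_num
    refine ⟨u, ?_, hx'.symm, hy'.symm⟩
    rw [hx', hy'] at hu
    field_simp at hu
    field_simp
    linear_combination hu / 4608
  · rintro (⟨rfl, rfl⟩ | ⟨u, hu, rfl, rfl⟩)
    · simp
    have hu0 : u ≠ 0 := by
      rintro rfl
      norm_num at hu
    have key : (1 / (96 * u ^ 3)) ^ 2 - (-1 / (24 * u ^ 2)) ^ 3 = u := by
      field_simp
      linear_combination (-127401984) * hu
    rw [key]
    constructor <;> field_simp <;> norm_num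


/-- The set of critical points of the polynomial map
`p(x,y) = (x² − y³)² + x·y` on `ℂ × ℂ`, i.e. the common zeros of
`∂p/∂x = 4x(x² − y³) + y` and `∂p/∂y = −6y²(x² − y³) + x`,
is finite and has exactly 8 elements. -/
theorem critical_points_finite_card_eight :
    ({z : ℂ × ℂ |
        4 * z.1 * (z.1 ^ 2 - z.2 ^ 3) + z.2 = 0 ∧
        -6 * z.2 ^ 2 * (z.1 ^ 2 - z.2 ^ 3) + z.1 = 0}).Finite ∧
    ({z : ℂ × ℂ |
        4 * z.1 * (z.1 ^ 2 - z.2 ^ 3) + z.2 = 0 ∧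
        -6 * z.2 ^ 2 * (z.1 ^ 2 - z.2 ^ 3) + z.1 = 0}).ncard = 8 := by
  have hc : (5 / 27648 : ℂ) ≠ 0 := by norm_num
  have hcard := Complex.ncard_setOf_pow_eq (n := 7) (by norm_num) hc
  have hfin : {u : ℂ | u ^ 7 = 5 / 27648}.Finite :=
    Set.finite_of_ncard_ne_zero (by rw [hcard]; norm_num)
  have hne : ∀ u ∈ {u : ℂ | u ^ 7 = 5 / 27648}, u ≠ 0 := by
    rintro u hu rfl
    norm_num at hu
  rw [critical_points_eq_insert_image]
  refine ⟨(hfin.image _).insert _, ?_⟩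
  rw [Set.ncard_insert_of_notMem _ (hfin.image _), Set.InjOn.ncard_image, hcard]
  · intro u hu v hv huv
    have hu0 := hne u hu
    have hv0 := hne v hv
    simp only [Prod.mk.injEq] at huv
    obtain ⟨h3, h2⟩ := huv
    field_simp at h3 h2
    have h2' : u ^ 2 = v ^ 2 := by linear_combination h2
    exact mul_left_cancel₀ (pow_ne_zero 2 hu0) (by linear_combination -h3 - v * h2')
  · rintro ⟨u, hu, h⟩
    have hu0 := hne u hu
    simp [hu0] at h
end

section
/- Let p(x,y) = (x² − y³)² + x·y ∈ ℂ[x,y]. Every critical point of p is nondegenerate: for every (x,y) ∈ ℂ × ℂ with ∂p/∂x(x,y) = 0 and ∂p/∂y(x,y) = 0, the Hessian determinant (∂²p/∂x²)(∂²p/∂y²) − (∂²p/∂x∂y)² is nonzero at (x,y). Consequently every singular point of every fibre p⁻¹(c), c ∈ ℂ, is an ordinary node. -/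
/-- Every critical point of `p(x,y) = (x² − y³)² + x·y` is nondegenerate:
at every common zero of `∂p/∂x = 4x(x² − y³) + y` and
`∂p/∂y = −6y²(x² − y³) + x`, the Hessian determinant
`(∂²p/∂x²)(∂²p/∂y²) − (∂²p/∂x∂y)²` is nonzero, where
`∂²p/∂x² = 12x² − 4y³`, `∂²p/∂y² = −12y(x² − y³) + 18y⁴` and
`∂²p/∂x∂y = −12xy² + 1`.  Hence every singular point of every fibre
of `p` is an ordinary node. -/
theorem critical_points_nondegenerate :
    ∀ x y : ℂ,
      4 * x * (x ^ 2 - y ^ 3) + y = 0 →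
      -6 * y ^ 2 * (x ^ 2 - y ^ 3) + x = 0 →
      (12 * x ^ 2 - 4 * y ^ 3) * (-12 * y * (x ^ 2 - y ^ 3) + 18 * y ^ 4)
        - (-12 * x * y ^ 2 + 1) ^ 2 ≠ 0 := by
  intro x y h₁ h₂
  have h : (x ^ 2 - y ^ 3) * (2 * x ^ 2 + 3 * y ^ 3) = 0 := by
    linear_combination (x * h₁ - y * h₂) / 2
  rcases mul_eq_zero.mp h with hu | hu
  · have hx : x = 0 := by linear_combination h₂ + 6 * y ^ 2 * hu
    have hy : y = 0 := by linear_combination h₁ - 4 * x * hu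
    simp [hx, hy]
  · have hx2 : x ^ 2 = -(3 / 2) * y ^ 3 := by linear_combination hu / 2
    rw [hx2] at h₁ h₂ ⊢
    have hx : x = -15 * y ^ 5 := by linear_combination h₂
    subst hx
    have hy : y * (150 * y ^ 7 + 1) = 0 := by linear_combination h₁
    rcases mul_eq_zero.mp hy with hy | hy
    · simp [hy]
    · have hy7 : y ^ 7 = -(1 / 150) := by linear_combination hy / 150
      have hessian_eq : (12 * (-(3 / 2) * y ^ 3) - 4 * y ^ 3)
          * (-12 * y * (-(3 / 2) * y ^ 3 - y ^ 3) + 18 * y ^ 4)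
          - (-12 * (-15 * y ^ 5) * y ^ 2 + 1) ^ 2 = 7 := by
        linear_combination (-1056 - 180 ^ 2 * (y ^ 7 - 1 / 150) - 360) * hy7
      rw [hessian_eq]
      norm_num
end

section
/- Let p : ℂ × ℂ → ℂ be given by p(x,y) = (x² − y³)² + x·y. There is a finite set S ⊂ ℂ such that for every c ∈ ℂ ∖ S, the fibre p⁻¹(c) = {(x,y) ∈ ℂ² : p(x,y) = c} is a smooth curve (it contains no common zero of ∂p/∂x and ∂p/∂y) and is a connected subset of ℂ². -/
open Polynomial Topology Filter

/-- If `‖p(z)‖ < ε ^ deg p` for a monic split polynomial `p`, then `p` has a root at distance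
less than `ε` from `z`. -/
lemma Polynomial.Splits.exists_root_norm_sub_lt {K : Type*} [NormedField K] {p : K[X]}
    (hs : p.Splits) (hm : p.Monic) {z : K} {ε : ℝ} (hε : 0 < ε)
    (h : ‖p.eval z‖ < ε ^ p.natDegree) : ∃ a, p.IsRoot a ∧ ‖z - a‖ < ε := by
  by_contra! hfar
  refine h.not_ge ?_
  have hle := Multiset.prod_map_le_prod_map₀ (s := p.roots) (fun _ ↦ ε) (fun b ↦ ‖z - b‖)
    (fun _ _ ↦ hε.le) fun b hb ↦ hfar b (isRoot_of_mem_roots hb)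
  have hprod : (p.roots.map fun x ↦ ‖z - x‖).prod = ‖p.eval z‖ := by
    rw [hs.eval_eq_prod_roots_of_monic hm]
    exact (p.roots.prod_hom' (NormedField.toMulRingNorm K) fun x : K ↦ z - x)
  rw [hprod] at hle
  simpa [hs.natDegree_eq_card_roots] using hle

/-- A closed subset of a product of proper spaces that is bounded over bounded sets of the second
factor has closed projection to that factor. -/
lemma IsClosed.image_snd_of_norm_fst_le {E F : Type*} [NormedAddCommGroup E] [ProperSpace E]
    [NormedAddCommGroup F] [ProperSpace F] {A : Set (E × F)} (hA : IsClosed A)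
    (hbdd : ∀ R : ℝ, ∃ M : ℝ, ∀ z ∈ A, ‖z.2‖ ≤ R → ‖z.1‖ ≤ M) :
    IsClosed (Prod.snd '' A) := by
  refine isClosed_of_closure_subset fun y hy ↦ ?_
  obtain ⟨M, hM⟩ := hbdd (‖y‖ + 1)
  set K : Set (E × F) := A ∩ Metric.closedBall 0 M ×ˢ Metric.closedBall 0 (‖y‖ + 1)
  have hK : IsCompact K :=
    ((isCompact_closedBall _ _).prod (isCompact_closedBall _ _)).inter_left hA
  have hyK : y ∈ closure (Prod.snd '' K) := by
    rw [Metric.mem_closure_iff] at hy ⊢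
    intro ε hε
    obtain ⟨_, ⟨z, hz, rfl⟩, hd⟩ := hy (min ε 1) (by positivity)
    have hz2 : ‖z.2‖ ≤ ‖y‖ + 1 := by
      have h1 := hd.trans_le (min_le_right _ _)
      rw [dist_comm, dist_eq_norm] at h1
      linarith [norm_le_norm_add_norm_sub' z.2 y]
    exact ⟨z.2, ⟨z, ⟨hz, by simpa using hM z hz hz2, by simpa using hz2⟩, rfl⟩,
      hd.trans_le (min_le_left _ _)⟩
  rw [(hK.image continuous_snd).isClosed.closure_eq] at hyK
  exact Set.image_mono Set.inter_subset_left hyK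

/-- A closed subset of a product on which the second projection is open and proper is preconnected
as soon as its part at infinity lies in a preconnected subset. -/
lemma isPreconnected_of_isPreconnected_at_infinity {E F : Type*}
    [NormedAddCommGroup E] [ProperSpace E] [NormedAddCommGroup F] [NormedSpace ℝ F]
    [ProperSpace F] [Nontrivial F]
    {Z Γ : Set (E × F)} (hZ : IsClosed Z)
    (hopen : ∀ z ∈ Z, ∀ U ∈ 𝓝 z, Prod.snd '' (Z ∩ U) ∈ 𝓝 z.2)
    (hbdd : ∀ R : ℝ, ∃ M : ℝ, ∀ z ∈ Z, ‖z.2‖ ≤ R → ‖z.1‖ ≤ M)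
    (hΓ : IsPreconnected Γ) (hΓZ : Γ ⊆ Z) {R : ℝ} (hR : ∀ z ∈ Z, R < ‖z.2‖ → z ∈ Γ) :
    IsPreconnected Z := by
  have key : ∀ u : Set (E × F), IsOpen u → IsClosed (Z ∩ u) → (Z ∩ u).Nonempty →
      (Γ ∩ u).Nonempty := by
    intro u hu hcl hne
    have hclosed : IsClosed (Prod.snd '' (Z ∩ u)) :=
      hcl.image_snd_of_norm_fst_le fun R ↦ (hbdd R).imp fun M hM z hz ↦ hM z hz.1
    have hop : IsOpen (Prod.snd '' (Z ∩ u)) := by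
      rw [isOpen_iff_mem_nhds]
      rintro _ ⟨z, hz, rfl⟩
      exact hopen z hz.1 u (hu.mem_nhds hz.2)
    have huniv := IsClopen.eq_univ ⟨hclosed, hop⟩ (hne.image _)
    obtain ⟨y, hy⟩ := NormedSpace.exists_lt_norm ℝ F R
    obtain ⟨z, hz, rfl⟩ : y ∈ Prod.snd '' (Z ∩ u) := huniv ▸ Set.mem_univ y
    exact ⟨z, hR z hz.1 hy, hz.2⟩
  intro u v hu hv hsub hnu hnv
  by_contra hempty
  have hdisj : ∀ z ∈ Z, z ∈ u → z ∉ v := fun z hz hzu hzv ↦ hempty ⟨z, hz, hzu, hzv⟩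
  have hZu : Z ∩ u = Z ∩ vᶜ := by
    ext z
    exact ⟨fun h ↦ ⟨h.1, hdisj z h.1 h.2⟩, fun h ↦ ⟨h.1, (hsub h.1).resolve_right h.2⟩⟩
  have hZv : Z ∩ v = Z ∩ uᶜ := by
    ext z
    exact ⟨fun h ↦ ⟨h.1, fun hzu ↦ hdisj z h.1 hzu h.2⟩,
      fun h ↦ ⟨h.1, (hsub h.1).resolve_left h.2⟩⟩
  obtain ⟨z, hz, hzuv⟩ := hΓ u v hu hv (hΓZ.trans hsub)
    (key u hu (hZu ▸ hZ.inter hv.isClosed_compl) hnu)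
    (key v hv (hZv ▸ hZ.inter hu.isClosed_compl) hnv)
  exact hempty ⟨z, hΓZ hz, hzuv⟩

lemma Complex.isPreconnected_setOf_lt_norm {ρ : ℝ} (hρ : 0 < ρ) :
    IsPreconnected {t : ℂ | ρ < ‖t‖} := by
  have himage : {t : ℂ | ρ < ‖t‖} = Complex.exp '' {w : ℂ | Real.log ρ < w.re} := by
    ext t
    constructor
    · intro ht
      have ht' : ρ < ‖t‖ := ht
      have ht0 : t ≠ 0 := norm_pos_iff.1 (hρ.trans ht')
      refine ⟨Complex.log t, ?_, Complex.exp_log ht0⟩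
      simpa [Complex.log_re] using Real.log_lt_log hρ ht'
    · rintro ⟨w, hw, rfl⟩
      simpa [Complex.norm_exp] using (Real.log_lt_iff_lt_exp hρ).1 hw
  rw [himage]
  exact (convex_halfSpace_re_gt _).isPreconnected.image _ Complex.continuous_exp.continuousOn

/-- The fibre over `y` of the projection of `p⁻¹(c)` to the second coordinate, as a quartic. -/
noncomputable def fibreQuartic (c y : ℂ) : ℂ[X] :=
  X ^ 4 + C (-2 * y ^ 3) * X ^ 2 + C y * X + C (y ^ 6 - c)

lemma fibreQuartic_natDegree (c y : ℂ) : (fibreQuartic c y).natDegree = 4 := by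
  unfold fibreQuartic
  compute_degree!

lemma fibreQuartic_monic (c y : ℂ) : (fibreQuartic c y).Monic := by
  unfold fibreQuartic
  monicity!

lemma fibreQuartic_eval (c x y : ℂ) :
    (fibreQuartic c y).eval x = (x ^ 2 - y ^ 3) ^ 2 + x * y - c := by
  simp [fibreQuartic]
  ring

/-- The projection of the fibre to the second coordinate is open. -/
lemma image_snd_fibre_mem_nhds (c : ℂ) {z : ℂ × ℂ}
    (hz : (z.1 ^ 2 - z.2 ^ 3) ^ 2 + z.1 * z.2 = c) {U : Set (ℂ × ℂ)} (hU : U ∈ 𝓝 z) :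
    Prod.snd '' ({z : ℂ × ℂ | (z.1 ^ 2 - z.2 ^ 3) ^ 2 + z.1 * z.2 = c} ∩ U) ∈ 𝓝 z.2 := by
  obtain ⟨ε, hε, hball⟩ := Metric.mem_nhds_iff.1 hU
  have hcont : ContinuousAt (fun y ↦ ‖(fibreQuartic c y).eval z.1‖) z.2 := by
    simp only [fibreQuartic_eval]
    fun_prop
  have hsmall : ∀ᶠ y in 𝓝 z.2, ‖(fibreQuartic c y).eval z.1‖ < ε ^ 4 := by
    refine hcont.eventually_lt continuousAt_const ?_
    simp only [fibreQuartic_eval, hz, sub_self, norm_zero]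
    positivity
  filter_upwards [hsmall, Metric.ball_mem_nhds z.2 hε] with y hy hyε
  obtain ⟨x, hx, hxε⟩ := (IsAlgClosed.splits _).exists_root_norm_sub_lt
    (fibreQuartic_monic c y) hε (by rwa [fibreQuartic_natDegree])
  refine ⟨(x, y), ⟨?_, hball ?_⟩, rfl⟩
  · rw [IsRoot, fibreQuartic_eval] at hx
    exact sub_eq_zero.1 hx
  · rw [Metric.mem_ball, Prod.dist_eq, max_lt_iff]
    exact ⟨by rwa [dist_comm, dist_eq_norm], hyε⟩

/-- The fibre is bounded over bounded sets of the second coordinate. -/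
lemma norm_fst_fibre_le (c : ℂ) (R : ℝ) : ∃ M : ℝ, ∀ z : ℂ × ℂ,
    (z.1 ^ 2 - z.2 ^ 3) ^ 2 + z.1 * z.2 = c → ‖z.2‖ ≤ R → ‖z.1‖ ≤ M := by
  refine ⟨1 + (2 * R ^ 3 + R + R ^ 6 + ‖c‖), fun z hz hR ↦ ?_⟩
  obtain ⟨x, y⟩ := z
  simp only at hz hR ⊢
  have hy := norm_nonneg y
  have hR0 : 0 ≤ R := hy.trans hR
  have hc := norm_nonneg c
  by_contra! hx
  have hN : 0 ≤ 2 * R ^ 3 + R + R ^ 6 + ‖c‖ := by positivity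
  have hx1 : 1 ≤ ‖x‖ := by linarith
  have heq : x ^ 4 = 2 * x ^ 2 * y ^ 3 - x * y - y ^ 6 + c := by linear_combination hz
  have hle : ‖x‖ ^ 4 ≤ 2 * ‖x‖ ^ 2 * ‖y‖ ^ 3 + ‖x‖ * ‖y‖ + ‖y‖ ^ 6 + ‖c‖ := by
    calc ‖x‖ ^ 4 = ‖2 * x ^ 2 * y ^ 3 - x * y - y ^ 6 + c‖ := by rw [← heq, norm_pow]
      _ ≤ ‖2 * x ^ 2 * y ^ 3‖ + ‖x * y‖ + ‖y ^ 6‖ + ‖c‖ :=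
        (norm_add_le _ _).trans <| add_le_add_left ((norm_sub_le _ _).trans <|
          add_le_add_left (norm_sub_le _ _) _) _
      _ = _ := by simp
  have hx2 : ‖x‖ ≤ ‖x‖ ^ 2 := by nlinarith
  have h3 : ‖y‖ ^ 3 ≤ R ^ 3 := by gcongr
  have h6 : ‖y‖ ^ 6 ≤ R ^ 6 := by gcongr
  have hbound : ‖x‖ ^ 4 ≤ ‖x‖ ^ 2 * (2 * R ^ 3 + R + R ^ 6 + ‖c‖) := by
    have e1 : 2 * ‖x‖ ^ 2 * ‖y‖ ^ 3 ≤ ‖x‖ ^ 2 * (2 * R ^ 3) := by nlinarith [sq_nonneg ‖x‖]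
    have e2 : ‖x‖ * ‖y‖ ≤ ‖x‖ ^ 2 * R := by gcongr
    have e3 : ‖y‖ ^ 6 + ‖c‖ ≤ ‖x‖ ^ 2 * (R ^ 6 + ‖c‖) := by
      have : 1 * (R ^ 6 + ‖c‖) ≤ ‖x‖ ^ 2 * (R ^ 6 + ‖c‖) := by
        gcongr
        linarith
      linarith
    linarith
  have hpos : 0 < ‖x‖ ^ 2 := by linarith
  have : ‖x‖ ^ 2 ≤ 2 * R ^ 3 + R + R ^ 6 + ‖c‖ :=
    le_of_mul_le_mul_left (by linarith [pow_add ‖x‖ 2 2]) hpos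
  linarith

/-- The Puiseux parametrization of the fibre at infinity:
`x = t⁶ + h(t) / t`, `y = t⁴` with `h(t) → i / 2`. -/
lemma exists_parametrization_at_infinity (c : ℂ) : ∃ ρ : ℝ, 1 ≤ ρ ∧ ∃ h : ℂ → ℂ,
    ContinuousOn h {t | ρ < ‖t‖} ∧ ∀ t, ρ < ‖t‖ → ‖h t - Complex.I / 2‖ < 1 / 4 ∧
      ((t ^ 6 + h t / t) ^ 2 - (t ^ 4) ^ 3) ^ 2 + (t ^ 6 + h t / t) * t ^ 4 = c := by
  set G : ℂ × ℂ → ℂ := fun q ↦ 4 * q.2 ^ 2 + 1 + 4 * q.2 ^ 3 * q.1 ^ 7 + q.2 ^ 4 * q.1 ^ 14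
    + q.2 * q.1 ^ 7 - c * q.1 ^ 10 with hG
  set u : ℂ × ℂ := (0, Complex.I / 2) with hu
  have hGu : G u = 0 := by
    simp only [hG, hu]
    linear_combination Complex.I_sq
  have hcd : ContDiffAt ℂ 1 G u := by
    simp only [hG]
    fun_prop
  have hderiv : ∀ w, (fderiv ℂ G u ∘L .inr ℂ ℂ ℂ) w = (4 * Complex.I) * w := by
    have h1 : HasFDerivAt (G ∘ fun v : ℂ ↦ ((0 : ℂ), v)) (fderiv ℂ G u ∘L .inr ℂ ℂ ℂ)
        (Complex.I / 2) :=
      HasFDerivAt.comp _ (hcd.differentiableAt one_ne_zero).hasFDerivAt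
        (hasFDerivAt_prodMk_right (0 : ℂ) (Complex.I / 2))
    have h2 : HasDerivAt (G ∘ fun v : ℂ ↦ ((0 : ℂ), v)) (4 * Complex.I) (Complex.I / 2) := by
      have h3 : (G ∘ fun v : ℂ ↦ ((0 : ℂ), v)) = fun v ↦ 4 * v ^ 2 + 1 := by
        ext v
        simp [hG]
      rw [h3]
      convert! (((hasDerivAt_id (Complex.I / 2)).pow 2).const_mul 4).add_const 1 using 1
      simp
      ring
    intro w
    rw [h1.unique h2.hasFDerivAt]
    simp [mul_comm]
  have hinv : (fderiv ℂ G u ∘L .inr ℂ ℂ ℂ).IsInvertible := by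
    have h4 : (4 * Complex.I : ℂ) ≠ 0 := by simp
    refine ⟨ContinuousLinearEquiv.unitsEquivAut ℂ (Units.mk0 _ h4), ?_⟩
    ext
    rw [hderiv]
    simp
  set g := hcd.implicitFunction one_ne_zero hinv
  have hgcd : ContDiffAt ℂ 1 g 0 := hcd.contDiffAt_implicitFunction one_ne_zero hinv
  have hg0 : g 0 = Complex.I / 2 := hcd.implicitFunction_apply_self one_ne_zero hinv
  have hzero : ∀ᶠ s in 𝓝 (0 : ℂ), G (s, g s) = 0 := by
    simpa [hGu] using hcd.eventually_apply_implicitFunction one_ne_zero hinv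
  have hcont : ∀ᶠ s in 𝓝 (0 : ℂ), ContinuousAt g s :=
    (hgcd.eventually (by simp)).mono fun s hs ↦ hs.continuousAt
  have hnear : ∀ᶠ s in 𝓝 (0 : ℂ), ‖g s - Complex.I / 2‖ < 1 / 4 := by
    refine ContinuousAt.eventually_lt (by have := hgcd.continuousAt; fun_prop)
      continuousAt_const ?_
    simp [hg0]
  obtain ⟨r, hr, hball⟩ := Metric.eventually_nhds_iff.1 (hzero.and (hcont.and hnear))
  have hmem : ∀ t : ℂ, max 1 r⁻¹ < ‖t‖ → t ≠ 0 ∧ dist t⁻¹ 0 < r := by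
    intro t ht
    have ht1 : 0 < ‖t‖ := by linarith [le_max_left 1 r⁻¹]
    refine ⟨norm_pos_iff.1 ht1, ?_⟩
    rw [dist_zero_right, norm_inv]
    exact inv_lt_of_inv_lt₀ hr ((le_max_right _ _).trans_lt ht)
  refine ⟨max 1 r⁻¹, le_max_left _ _, fun t ↦ g t⁻¹, ?_, ?_⟩
  · intro t ht
    obtain ⟨ht0, htr⟩ := hmem t ht
    exact ((hball htr).2.1.comp (continuousAt_inv₀ ht0)).continuousWithinAt
  · intro t ht
    obtain ⟨ht0, htr⟩ := hmem t ht
    obtain ⟨h1, -, h2⟩ := hball htr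
    refine ⟨h2, ?_⟩
    simp only [hG] at h1
    beta_reduce
    generalize g t⁻¹ = v at h1 ⊢
    field_simp at h1 ⊢
    linear_combination h1

/-- Over a point `t⁴` near infinity, the four branches given by the fourth roots of `t⁴` exhaust
the fibre. -/
lemma exists_branch_eq {c t x : ℂ} {ρ : ℝ} (hρ : 1 ≤ ρ) {h : ℂ → ℂ}
    (hh : ∀ t, ρ < ‖t‖ → ‖h t - Complex.I / 2‖ < 1 / 4 ∧
      ((t ^ 6 + h t / t) ^ 2 - (t ^ 4) ^ 3) ^ 2 + (t ^ 6 + h t / t) * t ^ 4 = c)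
    (ht : ρ < ‖t‖) (hx : (x ^ 2 - (t ^ 4) ^ 3) ^ 2 + x * t ^ 4 = c) :
    ∃ s, ρ < ‖s‖ ∧ s ^ 4 = t ^ 4 ∧ s ^ 6 + h s / s = x := by
  have ht1 : 1 < ‖t‖ := hρ.trans_lt ht
  have ht0 : t ≠ 0 := norm_pos_iff.1 (by linarith)
  have hI2 := Complex.I_sq
  have hI4 : Complex.I ^ 4 = 1 := Complex.I_pow_four
  have hT : 1 < ‖t ^ 7‖ := by
    rw [norm_pow]
    exact one_lt_pow₀ ht1 (by norm_num)
  have him : ∀ s, ρ < ‖s‖ → 0 < (h s).im := by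
    intro s hs
    have h1 := (Complex.abs_im_le_norm (h s - Complex.I / 2)).trans_lt (hh s hs).1
    have h2 := (abs_lt.1 h1).1
    simp at h2
    linarith
  have hnorm : ∀ s, ρ < ‖s‖ → ‖h s‖ < 3 / 4 := by
    intro s hs
    have h1 := (hh s hs).1
    have h2 : ‖Complex.I / 2‖ = 1 / 2 := by simp
    linarith [norm_le_norm_sub_add (h s) (Complex.I / 2)]
  have hlarge : ∀ a b w : ℂ, ‖a‖ < 3 / 4 → ‖b‖ < 3 / 4 → ‖w‖ = 1 → 2 * t ^ 7 ≠ a + w * b := by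
    intro a b w ha hb hw he
    have h1 := norm_add_le a (w * b)
    rw [← he, norm_mul, norm_mul, hw] at h1
    simp only [Complex.norm_ofNat, one_mul] at h1
    linarith
  have hn1 : ρ < ‖Complex.I * t‖ := by simpa using ht
  have hn2 : ρ < ‖-t‖ := by simpa using ht
  have hn3 : ρ < ‖-(Complex.I * t)‖ := by simpa using ht
  set X : ℂ → ℂ := fun s ↦ s ^ 6 + h s / s with hX
  have e0 : t * X t = t ^ 7 + h t := by
    simp only [hX]
    field_simp
  have e1 : t * X (Complex.I * t) = -t ^ 7 - Complex.I * h (Complex.I * t) := by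
    simp only [hX]
    generalize h (Complex.I * t) = a
    field_simp
    linear_combination (Complex.I * t ^ 7 * (Complex.I ^ 4 - Complex.I ^ 2 + 1) + a) * hI2
  have e2 : t * X (-t) = t ^ 7 - h (-t) := by
    simp only [hX]
    field_simp
    ring
  have e3 : t * X (-(Complex.I * t)) = -t ^ 7 + Complex.I * h (-(Complex.I * t)) := by
    simp only [hX]
    generalize h (-(Complex.I * t)) = a
    field_simp
    linear_combination (Complex.I * t ^ 7 * (Complex.I ^ 4 - Complex.I ^ 2 + 1) - a) * hI2
  have n01 : X t ≠ X (Complex.I * t) := fun he ↦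
    hlarge (-h t) _ (-Complex.I) (by rw [norm_neg]; exact hnorm _ ht) (hnorm _ hn1) (by simp)
      (by linear_combination t * he - e0 + e1)
  have n03 : X t ≠ X (-(Complex.I * t)) := fun he ↦
    hlarge (-h t) _ Complex.I (by rw [norm_neg]; exact hnorm _ ht) (hnorm _ hn3) (by simp)
      (by linear_combination t * he - e0 + e3)
  have n21 : X (-t) ≠ X (Complex.I * t) := fun he ↦
    hlarge _ _ (-Complex.I) (hnorm _ hn2) (hnorm _ hn1) (by simp)
      (by linear_combination t * he - e2 + e1)
  have n23 : X (-t) ≠ X (-(Complex.I * t)) := fun he ↦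
    hlarge _ _ Complex.I (hnorm _ hn2) (hnorm _ hn3) (by simp)
      (by linear_combination t * he - e2 + e3)
  have n02 : X t ≠ X (-t) := fun he ↦ by
    have h0 : h t + h (-t) = 0 := by linear_combination t * he - e0 + e2
    have := congrArg Complex.im h0
    simp only [Complex.add_im, Complex.zero_im] at this
    linarith [him _ ht, him _ hn2]
  have n13 : X (Complex.I * t) ≠ X (-(Complex.I * t)) := fun he ↦ by
    have h0 : h (Complex.I * t) + h (-(Complex.I * t)) = 0 :=
      mul_left_cancel₀ Complex.I_ne_zero (by linear_combination -t * he + e1 - e3)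
    have := congrArg Complex.im h0
    simp only [Complex.add_im, Complex.zero_im] at this
    linarith [him _ hn1, him _ hn3]
  by_contra! hne
  replace hne : ∀ s, ρ < ‖s‖ → s ^ 4 = t ^ 4 → X s ≠ x := hne
  have p1 : (Complex.I * t) ^ 4 = t ^ 4 := by rw [mul_pow, hI4, one_mul]
  have p2 : (-t) ^ 4 = t ^ 4 := by ring
  have p3 : (-(Complex.I * t)) ^ 4 = t ^ 4 := by rw [← p1]; ring
  have hroot : ∀ s, ρ < ‖s‖ → s ^ 4 = t ^ 4 → (fibreQuartic c (t ^ 4)).eval (X s) = 0 := by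
    intro s hs hst
    rw [fibreQuartic_eval, sub_eq_zero, ← hst]
    exact (hh s hs).2
  refine (fibreQuartic_monic c (t ^ 4)).ne_zero
    (eq_zero_of_natDegree_lt_card_of_eval_eq_zero' _
      {X t, X (Complex.I * t), X (-t), X (-(Complex.I * t)), x} ?_ ?_)
  · simp only [Finset.mem_insert, Finset.mem_singleton, forall_eq_or_imp, forall_eq]
    exact ⟨hroot _ ht rfl, hroot _ hn1 p1, hroot _ hn2 p2, hroot _ hn3 p3,
      by rw [fibreQuartic_eval, hx, sub_self]⟩
  · rw [fibreQuartic_natDegree, Finset.card_insert_of_notMem, Finset.card_insert_of_notMem,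
      Finset.card_insert_of_notMem, Finset.card_pair (hne _ hn3 p3)]
    · norm_num
    · simp [n23, hne _ hn2 p2]
    · simp [n21.symm, n13, hne _ hn1 p1]
    · simp [n01, n02, n03, hne _ ht rfl]

lemma isConnected_fibre (c : ℂ) :
    IsConnected {z : ℂ × ℂ | (z.1 ^ 2 - z.2 ^ 3) ^ 2 + z.1 * z.2 = c} := by
  constructor
  · obtain ⟨x, hx⟩ := IsAlgClosed.exists_pow_nat_eq c (n := 4) (by norm_num)
    exact ⟨(x, 0), by simp only [Set.mem_ofPred_eq]; linear_combination hx⟩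
  obtain ⟨ρ, hρ, h, hcont, hh⟩ := exists_parametrization_at_infinity c
  have hρ0 : 0 < ρ := one_pos.trans_le hρ
  refine isPreconnected_of_isPreconnected_at_infinity (R := ρ ^ 4)
    (Γ := (fun t : ℂ ↦ (t ^ 6 + h t / t, t ^ 4)) '' {t | ρ < ‖t‖})
    (isClosed_eq (by fun_prop) continuous_const)
    (fun z hz U hU ↦ image_snd_fibre_mem_nhds c hz hU) (norm_fst_fibre_le c)
    ((Complex.isPreconnected_setOf_lt_norm hρ0).image _ ?_) ?_ ?_
  · have hne : ∀ t ∈ {t : ℂ | ρ < ‖t‖}, t ≠ 0 := fun t ht ↦ norm_pos_iff.1 (hρ0.trans ht)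
    exact ((continuousOn_id.pow 6).add (hcont.div continuousOn_id hne)).prodMk
      (continuousOn_id.pow 4)
  · rintro _ ⟨t, ht, rfl⟩
    exact (hh t ht).2
  · rintro ⟨x, y⟩ hxy hy
    obtain ⟨t, rfl⟩ := IsAlgClosed.exists_pow_nat_eq y (n := 4) (by norm_num)
    have ht : ρ < ‖t‖ := lt_of_pow_lt_pow_left₀ 4 (norm_nonneg t) (by simpa using hy)
    obtain ⟨s, hs, hst, hsx⟩ := exists_branch_eq hρ hh ht hxy
    exact ⟨s, hs, Prod.ext hsx hst⟩

/-- The value of the polynomial at a critical point is `0` or satisfies an explicit equation. -/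
lemma critical_value_eq {x y : ℂ} (h1 : 4 * x * (x ^ 2 - y ^ 3) + y = 0)
    (h2 : -6 * y ^ 2 * (x ^ 2 - y ^ 3) + x = 0) :
    (x ^ 2 - y ^ 3) ^ 2 + x * y = 0 ∨
      ((x ^ 2 - y ^ 3) ^ 2 + x * y) ^ 7 = (-7 / 5) ^ 7 * (5 / 27648) ^ 2 := by
  obtain ⟨u, hu⟩ : ∃ u, u = x ^ 2 - y ^ 3 := ⟨_, rfl⟩
  rw [← hu] at h1 h2 ⊢
  have hx : x = 6 * y ^ 2 * u := by linear_combination h2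
  by_cases hy : y = 0
  · left
    have hx0 : x = 0 := by rw [hx, hy]; ring
    rw [hu, hx0, hy]
    ring
  right
  have hyu : y * u ^ 2 = -1 / 24 := by
    refine mul_left_cancel₀ hy ?_
    rw [hx] at h1
    linear_combination h1 / 24
  have hu0 : u ≠ 0 := by
    rintro rfl
    norm_num at hyu
  have hu7 : u ^ 7 = 5 / 27648 := by
    have : u ^ 7 = 36 * (y * u ^ 2) ^ 4 - (y * u ^ 2) ^ 3 := by
      rw [hx] at hu
      linear_combination u ^ 6 * hu
    rw [this, hyu]
    norm_num
  have hc : u ^ 2 + x * y = -7 / 5 * u ^ 2 := by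
    refine mul_left_cancel₀ (pow_ne_zero 5 hu0) ?_
    have : u ^ 5 * (x * y) = 6 * (y * u ^ 2) ^ 3 := by
      rw [hx]
      ring
    rw [hyu] at this
    linear_combination this + 12 / 5 * hu7
  rw [hc, mul_pow, ← pow_mul, mul_comm 2 7, pow_mul, hu7]



/-- For `p(x,y) = (x² − y³)² + x·y` there is a finite set `S ⊂ ℂ` such
that for every `c ∉ S` the fibre `p⁻¹(c)` is a smooth curve (contains no
common zero of the partial derivatives `4x(x² − y³) + y` and
`−6y²(x² − y³) + x`) and is connected. -/
theorem generic_fibre_smooth_connected :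
    ∃ S : Set ℂ, S.Finite ∧ ∀ c : ℂ, c ∉ S →
      (∀ z : ℂ × ℂ, (z.1 ^ 2 - z.2 ^ 3) ^ 2 + z.1 * z.2 = c →
        ¬(4 * z.1 * (z.1 ^ 2 - z.2 ^ 3) + z.2 = 0 ∧
          -6 * z.2 ^ 2 * (z.1 ^ 2 - z.2 ^ 3) + z.1 = 0)) ∧
      IsConnected {z : ℂ × ℂ | (z.1 ^ 2 - z.2 ^ 3) ^ 2 + z.1 * z.2 = c} := by
  refine ⟨{0} ∪ {c | c ^ 7 = (-7 / 5) ^ 7 * (5 / 27648) ^ 2}, ?_,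
    fun c hc ↦ ⟨?_, isConnected_fibre c⟩⟩
  · refine (Set.finite_singleton _).union ?_
    refine (nthRoots 7 ((-7 / 5 : ℂ) ^ 7 * (5 / 27648) ^ 2)).toFinset.finite_toSet.subset
      fun c hc ↦ ?_
    simpa [mem_nthRoots] using hc
  · rintro z rfl ⟨h1, h2⟩
    exact hc (critical_value_eq h1 h2)
end

section
/- For every c ∈ ℂ, the polynomial (x² − y³)² + x·y − c ∈ ℂ[x,y] is squarefree, i.e. it is not divisible by the square of any non-unit polynomial in ℂ[x,y]. -/
open MvPolynomial

theorem Derivation.dvd_of_sq_dvd {R A : Type*} [CommRing R] [CommRing A] [Algebra R A]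
    (D : Derivation R A A) {g p : A} (h : g * g ∣ p) : g ∣ D p := by
  obtain ⟨q, rfl⟩ := h
  simp only [Derivation.leibniz, smul_eq_mul]
  exact ⟨g * D q + 2 * q * D g, by ring⟩

theorem MvPolynomial.degreeOf_eq_zero_of_dvd {σ R : Type*} [CommRing R] [IsDomain R]
    {i : σ} {g p : MvPolynomial σ R} (hp : p ≠ 0) (hi : p.degreeOf i = 0) (h : g ∣ p) :
    g.degreeOf i = 0 := by
  obtain ⟨q, rfl⟩ := h
  rw [degreeOf_mul_eq (left_ne_zero_of_mul hp) (right_ne_zero_of_mul hp)] at hi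
  omega

/-- For every `c ∈ ℂ`, the polynomial `(x² − y³)² + x·y − c ∈ ℂ[x,y]`
is squarefree. -/
theorem fibre_polynomial_squarefree :
    ∀ c : ℂ,
      Squarefree
        (((X 0 : MvPolynomial (Fin 2) ℂ) ^ 2 - (X 1) ^ 3) ^ 2
          + X 0 * X 1 - C c) := by
  intro c g hg
  set x : MvPolynomial (Fin 2) ℂ := X 0
  set y : MvPolynomial (Fin 2) ℂ := X 1 with hy
  have hxx : pderiv 0 x = 1 := pderiv_X_self 0
  have hxy : pderiv 0 y = 0 := pderiv_X_of_ne (by decide)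
  have hyx : pderiv 1 x = 0 := pderiv_X_of_ne (by decide)
  have hyy : pderiv 1 y = 1 := pderiv_X_self 1
  have hgx : g ∣ 4 * x * (x ^ 2 - y ^ 3) + y := by
    convert (pderiv 0).dvd_of_sq_dvd hg using 1
    simp [Derivation.leibniz, Derivation.leibniz_pow, hxx, hxy]
    ring
  have hgy : g ∣ x - 6 * y ^ 2 * (x ^ 2 - y ^ 3) := by
    convert (pderiv 1).dvd_of_sq_dvd hg using 1
    simp [Derivation.leibniz, Derivation.leibniz_pow, hyx, hyy]
    ring
  have hcusp : g ∣ 2 * x ^ 2 + 3 * y ^ 3 := by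
    convert dvd_add (hgx.mul_left (3 * y ^ 2)) (hgy.mul_left (2 * x)) using 1
    ring
  have hgraph : g ∣ x + 15 * y ^ 5 := by
    convert dvd_add hgy (hcusp.mul_left (3 * y ^ 2)) using 1
    ring
  have hgline : g ∣ y + 150 * y ^ 8 := by
    convert dvd_add (dvd_sub hgx (hcusp.mul_left (2 * x))) (hgraph.mul_left (10 * y ^ 3)) using 1
    ring
  have hne : y + 150 * y ^ 8 ≠ 0 := by
    intro h
    have h1 := congrArg (eval fun _ => (1 : ℂ)) h
    norm_num [hy] at h1
  have hy0 : degreeOf 0 y = 0 := by simp [hy, degreeOf_X]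
  have hdeg : degreeOf 0 (y + 150 * y ^ 8) = 0 := by
    have h1 : degreeOf 0 (y ^ 8) = 0 := by
      simpa [hy0] using degreeOf_pow_le 0 y 8
    have h2 : degreeOf 0 (C 150 * y ^ 8) = 0 :=
      Nat.le_zero.mp ((degreeOf_C_mul_le (y ^ 8) 0 150).trans_eq h1)
    rw [map_ofNat] at h2
    have h3 := degreeOf_add_le 0 y (150 * y ^ 8)
    rwa [hy0, h2, max_self, nonpos_iff_eq_zero] at h3
  have hg0 : pderiv 0 g = 0 := by
    apply pderiv_eq_zero_of_notMem_vars
    rw [mem_vars_iff_degreeOf_ne_zero, not_not]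
    exact degreeOf_eq_zero_of_dvd hne hdeg hgline
  obtain ⟨q, hq⟩ := hgraph
  refine IsUnit.of_mul_eq_one (pderiv 0 q) ?_
  have h15 : pderiv 0 (15 : MvPolynomial (Fin 2) ℂ) = 0 := (pderiv 0).map_natCast 15
  simpa [Derivation.leibniz, Derivation.leibniz_pow, hxx, hxy, hg0, h15] using
    (congrArg (pderiv 0) hq).symm
end
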